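/- (One-dimensional characterization of the Neumann existence set: I_N = (q̂_N, 1).) Let L > 0 and let a : [0,L] → ℝ be continuous, change sign, and satisfy ∫₀^L a(x) dx < 0. Then there exists q̂_N ∈ [0,1) such that for every q ∈ (0,1) the following equivalence holds: the Neumann problem (P_N) with weight a and exponent q has a strongly positive solution (u > 0 on all of [0,L]) if and only if q̂_N < q. -/

import Mathlib

open Real Set

/-- `u` (with first and second derivatives `u'`, `u''`) is a solution of the
one-dimensional Neumann problem `(P_N)` on `[0, L]` with weight `a` and exponent `q`:
`u` is twice continuously differentiable on `[0, L]`, nonnegative, has vanishing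
derivative at the endpoints, and satisfies `-u'' = a(x) u^q` on `[0, L]`. -/
def NeumannSolution (L q : ℝ) (a u u' u'' : ℝ → ℝ) : Prop :=
  (∀ x ∈ Set.Icc (0 : ℝ) L, HasDerivWithinAt u (u' x) (Set.Icc 0 L) x) ∧
  (∀ x ∈ Set.Icc (0 : ℝ) L, HasDerivWithinAt u' (u'' x) (Set.Icc 0 L) x) ∧
  ContinuousOn u'' (Set.Icc 0 L) ∧
  (∀ x ∈ Set.Icc (0 : ℝ) L, 0 ≤ u x) ∧
  u' 0 = 0 ∧ u' L = 0 ∧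
  (∀ x ∈ Set.Icc (0 : ℝ) L, -u'' x = a x * u x ^ q)

/-- The weight `a` changes sign on `[0, L]`: it attains both positive and negative
values. -/
def ChangesSign (L : ℝ) (a : ℝ → ℝ) : Prop :=
  (∃ x ∈ Set.Icc (0 : ℝ) L, 0 < a x) ∧ (∃ x ∈ Set.Icc (0 : ℝ) L, a x < 0)

/-- `u` is twice continuously differentiable on `[0, L]`, with derivatives `u'` and `u''`. -/
structure IsC2 (L : ℝ) (u u' u'' : ℝ → ℝ) : Prop where
  hasDeriv : ∀ x ∈ Icc (0 : ℝ) L, HasDerivWithinAt u (u' x) (Icc 0 L) x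
  hasDeriv' : ∀ x ∈ Icc (0 : ℝ) L, HasDerivWithinAt u' (u'' x) (Icc 0 L) x
  cont'' : ContinuousOn u'' (Icc 0 L)

namespace IsC2

variable {L : ℝ} {u u' u'' : ℝ → ℝ}

lemma cont (h : IsC2 L u u' u'') : ContinuousOn u (Icc 0 L) :=
  fun x hx => (h.hasDeriv x hx).continuousWithinAt

lemma cont' (h : IsC2 L u u' u'') : ContinuousOn u' (Icc 0 L) :=
  fun x hx => (h.hasDeriv' x hx).continuousWithinAt

lemma neg (h : IsC2 L u u' u'') : IsC2 L (fun x => -u x) (fun x => -u' x) (fun x => -u'' x) :=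
  ⟨fun x hx => (h.hasDeriv x hx).neg, fun x hx => (h.hasDeriv' x hx).neg, h.cont''.neg⟩

end IsC2

/-- The nearest-point retraction of `ℝ` onto `[0, L]`. -/
noncomputable def clamp (L x : ℝ) : ℝ := max 0 (min x L)

lemma clamp_mem {L : ℝ} (hL : 0 ≤ L) (x : ℝ) : clamp L x ∈ Icc 0 L :=
  ⟨le_max_left _ _, max_le hL (min_le_right _ _)⟩

lemma clamp_of_mem {L x : ℝ} (hx : x ∈ Icc 0 L) : clamp L x = x := by
  rw [clamp, min_eq_left hx.2, max_eq_right hx.1]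

lemma continuous_clamp (L : ℝ) : Continuous (clamp L) := by
  unfold clamp; fun_prop

lemma ContinuousOn.comp_clamp {L : ℝ} (hL : 0 ≤ L) {f : ℝ → ℝ} (hf : ContinuousOn f (Icc 0 L)) :
    Continuous fun x => f (clamp L x) :=
  hf.comp_continuous (continuous_clamp L) (clamp_mem hL)

lemma integral_eq_sub_of_hasDerivWithinAt_Icc {L s r : ℝ} {F f : ℝ → ℝ} (hs : 0 ≤ s)
    (hsr : s ≤ r) (hr : r ≤ L)
    (hF : ∀ x ∈ Icc (0 : ℝ) L, HasDerivWithinAt F (f x) (Icc 0 L) x)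
    (hf : ContinuousOn f (Icc 0 L)) : ∫ t in s..r, f t = F r - F s := by
  have hsub : Icc s r ⊆ Icc 0 L := Icc_subset_Icc hs hr
  refine intervalIntegral.integral_eq_sub_of_hasDerivAt_of_le hsr
    (fun x hx => ((hF x (hsub hx)).continuousWithinAt).mono hsub) (fun x hx => ?_) ?_
  · exact (hF x (hsub (Ioo_subset_Icc_self hx))).hasDerivAt
      (Icc_mem_nhds (hs.trans_lt hx.1) (hx.2.trans_le hr))
  · apply ContinuousOn.intervalIntegrable
    rw [uIcc_of_le hsr]
    exact hf.mono hsub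

/-- The solution operator of `-w'' + k² w = h` on `[0, L]` with Neumann boundary conditions. -/
noncomputable def green (k L : ℝ) (h : ℝ → ℝ) (x : ℝ) : ℝ :=
  (cosh (k * (L - x)) * (∫ t in (0 : ℝ)..x, cosh (k * t) * h t) +
    cosh (k * x) * ∫ t in x..L, cosh (k * (L - t)) * h t) / (k * sinh (k * L))

/-- The derivative of `green k L h`. -/
noncomputable def greenDeriv (k L : ℝ) (h : ℝ → ℝ) (x : ℝ) : ℝ :=
  (-sinh (k * (L - x)) * (∫ t in (0 : ℝ)..x, cosh (k * t) * h t) +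
    sinh (k * x) * ∫ t in x..L, cosh (k * (L - t)) * h t) / sinh (k * L)

lemma mul_sinh_pos {k L : ℝ} (hk : 0 < k) (hL : 0 < L) : 0 < k * sinh (k * L) :=
  mul_pos hk (sinh_pos_iff.2 (mul_pos hk hL))

lemma hasDerivAt_integral_left {g : ℝ → ℝ} (hg : Continuous g) (L x : ℝ) :
    HasDerivAt (fun y => ∫ t in y..L, g t) (-g x) x :=
  intervalIntegral.integral_hasDerivAt_left (hg.intervalIntegrable _ _)
    (hg.stronglyMeasurableAtFilter _ _) hg.continuousAt

lemma hasDerivAt_integral_right {g : ℝ → ℝ} (hg : Continuous g) (x : ℝ) :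
    HasDerivAt (fun y => ∫ t in (0 : ℝ)..y, g t) (g x) x :=
  intervalIntegral.integral_hasDerivAt_right (hg.intervalIntegrable _ _)
    (hg.stronglyMeasurableAtFilter _ _) hg.continuousAt

lemma hasDerivAt_green {k L : ℝ} (hk : 0 < k) (hL : 0 < L) {h : ℝ → ℝ} (hh : Continuous h)
    (x : ℝ) : HasDerivAt (green k L h) (greenDeriv k L h x) x := by
  have hS : sinh (k * L) ≠ 0 := (sinh_pos_iff.2 (mul_pos hk hL)).ne'
  have h1 := hasDerivAt_integral_right (g := fun t => cosh (k * t) * h t) (by fun_prop) x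
  have h2 := hasDerivAt_integral_left (g := fun t => cosh (k * (L - t)) * h t) (by fun_prop) L x
  have h3 : HasDerivAt (fun x => cosh (k * (L - x))) (sinh (k * (L - x)) * (k * -1)) x :=
    (((hasDerivAt_id x).const_sub L).const_mul k).cosh
  have h4 : HasDerivAt (fun x => cosh (k * x)) (sinh (k * x) * (k * 1)) x :=
    ((hasDerivAt_id x).const_mul k).cosh
  refine (((h3.mul h1).add (h4.mul h2)).div_const (k * sinh (k * L))).congr_deriv ?_
  unfold greenDeriv
  field_simp
  ring

lemma hasDerivAt_greenDeriv {k L : ℝ} (hk : 0 < k) (hL : 0 < L) {h : ℝ → ℝ} (hh : Continuous h)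
    (x : ℝ) : HasDerivAt (greenDeriv k L h) (k ^ 2 * green k L h x - h x) x := by
  have hS : sinh (k * L) ≠ 0 := (sinh_pos_iff.2 (mul_pos hk hL)).ne'
  have h1 := hasDerivAt_integral_right (g := fun t => cosh (k * t) * h t) (by fun_prop) x
  have h2 := hasDerivAt_integral_left (g := fun t => cosh (k * (L - t)) * h t) (by fun_prop) L x
  have h3 : HasDerivAt (fun x => -sinh (k * (L - x))) (-(cosh (k * (L - x)) * (k * -1))) x :=
    (((hasDerivAt_id x).const_sub L).const_mul k).sinh.neg
  have h4 : HasDerivAt (fun x => sinh (k * x)) (cosh (k * x) * (k * 1)) x :=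
    ((hasDerivAt_id x).const_mul k).sinh
  refine (((h3.mul h1).add (h4.mul h2)).div_const (sinh (k * L))).congr_deriv ?_
  have hadd : sinh (k * L) =
      sinh (k * (L - x)) * cosh (k * x) + cosh (k * (L - x)) * sinh (k * x) := by
    rw [← sinh_add]; ring_nf
  unfold green
  field_simp
  rw [hadd]
  ring

lemma greenDeriv_zero (k L : ℝ) (h : ℝ → ℝ) : greenDeriv k L h 0 = 0 := by
  simp [greenDeriv]

lemma greenDeriv_right (k L : ℝ) (h : ℝ → ℝ) : greenDeriv k L h L = 0 := by
  simp [greenDeriv]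

lemma green_neg (k L : ℝ) (h : ℝ → ℝ) (x : ℝ) :
    green k L (fun t => -h t) x = -green k L h x := by
  simp only [green, mul_neg, intervalIntegral.integral_neg]
  ring

lemma green_mono {k L : ℝ} (hk : 0 < k) (hL : 0 < L) {f g : ℝ → ℝ}
    (hf : ContinuousOn f (Icc 0 L)) (hg : ContinuousOn g (Icc 0 L))
    (h : ∀ t ∈ Icc 0 L, f t ≤ g t) {x : ℝ} (hx : x ∈ Icc 0 L) :
    green k L f x ≤ green k L g x := by
  have hsub1 : Icc 0 x ⊆ Icc 0 L := Icc_subset_Icc_right hx.2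
  have hsub2 : Icc x L ⊆ Icc 0 L := Icc_subset_Icc_left hx.1
  have hint1 {f : ℝ → ℝ} (hf : ContinuousOn f (Icc 0 L)) :
      IntervalIntegrable (fun t => cosh (k * t) * f t) MeasureTheory.volume 0 x := by
    apply ContinuousOn.intervalIntegrable
    rw [uIcc_of_le hx.1]
    exact ContinuousOn.mul (by fun_prop) (hf.mono hsub1)
  have hint2 {f : ℝ → ℝ} (hf : ContinuousOn f (Icc 0 L)) :
      IntervalIntegrable (fun t => cosh (k * (L - t)) * f t) MeasureTheory.volume x L := by
    apply ContinuousOn.intervalIntegrable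
    rw [uIcc_of_le hx.2]
    exact ContinuousOn.mul (by fun_prop) (hf.mono hsub2)
  have h1 := intervalIntegral.integral_mono_on hx.1 (hint1 hf) (hint1 hg)
    fun t ht => mul_le_mul_of_nonneg_left (h t (hsub1 ht)) (cosh_pos _).le
  have h2 := intervalIntegral.integral_mono_on hx.2 (hint2 hf) (hint2 hg)
    fun t ht => mul_le_mul_of_nonneg_left (h t (hsub2 ht)) (cosh_pos _).le
  have hS := mul_sinh_pos hk hL
  have hc1 := cosh_pos (k * (L - x))
  have hc2 := cosh_pos (k * x)
  unfold green
  gcongr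

lemma le_green {k L : ℝ} (hk : 0 < k) (hL : 0 < L) {w w' w'' : ℝ → ℝ} (hw : IsC2 L w w' w'')
    (h0 : 0 ≤ w' 0) (h1 : w' L ≤ 0) {x : ℝ} (hx : x ∈ Icc 0 L) :
    w x ≤ green k L (fun t => k ^ 2 * w t - w'' t) x := by
  have hcont : ContinuousOn (fun t => k ^ 2 * w t - w'' t) (Icc 0 L) :=
    (hw.cont.const_smul (k ^ 2)).sub hw.cont''
  have e1 : ∫ t in (0 : ℝ)..x, cosh (k * t) * (k ^ 2 * w t - w'' t) =
      (k * sinh (k * x) * w x - cosh (k * x) * w' x) -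
        (k * sinh (k * 0) * w 0 - cosh (k * 0) * w' 0) := by
    refine integral_eq_sub_of_hasDerivWithinAt_Icc (L := L)
      (F := fun t => k * sinh (k * t) * w t - cosh (k * t) * w' t) le_rfl hx.1 hx.2
      (fun t ht => ?_) (ContinuousOn.mul (by fun_prop) hcont)
    have hc : HasDerivAt (fun x => cosh (k * x)) (sinh (k * t) * (k * 1)) t :=
      ((hasDerivAt_id t).const_mul k).cosh
    have hs : HasDerivAt (fun x => k * sinh (k * x)) (k * (cosh (k * t) * (k * 1))) t :=
      ((hasDerivAt_id t).const_mul k).sinh.const_mul k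
    refine ((hs.hasDerivWithinAt.mul (hw.hasDeriv t ht)).sub
      (hc.hasDerivWithinAt.mul (hw.hasDeriv' t ht))).congr_deriv ?_
    ring
  have e2 : ∫ t in x..L, cosh (k * (L - t)) * (k ^ 2 * w t - w'' t) =
      (-(k * sinh (k * (L - L))) * w L - cosh (k * (L - L)) * w' L) -
        (-(k * sinh (k * (L - x))) * w x - cosh (k * (L - x)) * w' x) := by
    refine integral_eq_sub_of_hasDerivWithinAt_Icc (L := L)
      (F := fun t => -(k * sinh (k * (L - t))) * w t - cosh (k * (L - t)) * w' t) hx.1 hx.2 le_rfl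
      (fun t ht => ?_) (ContinuousOn.mul (by fun_prop) hcont)
    have hc : HasDerivAt (fun x => cosh (k * (L - x))) (sinh (k * (L - t)) * (k * -1)) t :=
      (((hasDerivAt_id t).const_sub L).const_mul k).cosh
    have hs : HasDerivAt (fun x => -(k * sinh (k * (L - x))))
        (-(k * (cosh (k * (L - t)) * (k * -1)))) t :=
      ((((hasDerivAt_id t).const_sub L).const_mul k).sinh.const_mul k).neg
    refine ((hs.hasDerivWithinAt.mul (hw.hasDeriv t ht)).sub
      (hc.hasDerivWithinAt.mul (hw.hasDeriv' t ht))).congr_deriv ?_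
    ring
  have hadd : sinh (k * L) =
      sinh (k * (L - x)) * cosh (k * x) + cosh (k * (L - x)) * sinh (k * x) := by
    rw [← sinh_add]; ring_nf
  rw [green, e1, e2, le_div_iff₀ (mul_sinh_pos hk hL), hadd]
  simp only [sub_self, mul_zero, sinh_zero, cosh_zero]
  have p1 := mul_nonneg (cosh_pos (k * (L - x))).le h0
  have p2 := mul_nonneg (cosh_pos (k * x)).le (neg_nonneg.2 h1)
  linarith

lemma green_le {k L : ℝ} (hk : 0 < k) (hL : 0 < L) {w w' w'' : ℝ → ℝ} (hw : IsC2 L w w' w'')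
    (h0 : w' 0 ≤ 0) (h1 : 0 ≤ w' L) {x : ℝ} (hx : x ∈ Icc 0 L) :
    green k L (fun t => k ^ 2 * w t - w'' t) x ≤ w x := by
  have h := le_green hk hL hw.neg (by linarith) (by linarith) hx
  have e : (fun t => k ^ 2 * -w t - -w'' t) = fun t => -(k ^ 2 * w t - w'' t) := by
    ext t; ring
  rw [e, green_neg] at h
  linarith

lemma continuous_green {k L : ℝ} {h : ℝ → ℝ}
    (hh : ∀ s t, IntervalIntegrable h MeasureTheory.volume s t) : Continuous (green k L h) := by
  have h1 : Continuous fun x => ∫ t in (0 : ℝ)..x, cosh (k * t) * h t :=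
    intervalIntegral.continuous_primitive
      (fun s t => (hh s t).continuousOn_mul (by fun_prop)) 0
  have h2 : Continuous fun x => ∫ t in x..L, cosh (k * (L - t)) * h t := by
    simp_rw [fun x => intervalIntegral.integral_symm (μ := MeasureTheory.volume)
      (f := fun t => cosh (k * (L - t)) * h t) L x]
    exact (intervalIntegral.continuous_primitive
      (fun s t => (hh s t).continuousOn_mul (by fun_prop)) L).neg
  unfold green
  fun_prop

lemma tendsto_green {k L C : ℝ} {h : ℕ → ℝ → ℝ} {h' : ℝ → ℝ} (hc : ∀ n, Continuous (h n))
    (hb : ∀ n t, |h n t| ≤ C)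
    (hlim : ∀ t, Filter.Tendsto (fun n => h n t) Filter.atTop (nhds (h' t)))
    (x : ℝ) :
    Filter.Tendsto (fun n => green k L (h n) x) Filter.atTop (nhds (green k L h' x)) := by
  have key (g : ℝ → ℝ) (hg : Continuous g) (s t : ℝ) :
      Filter.Tendsto (fun n => ∫ r in s..t, g r * h n r) Filter.atTop
        (nhds (∫ r in s..t, g r * h' r)) := by
    refine intervalIntegral.tendsto_integral_filter_of_dominated_convergence
      (fun r => |g r| * C) (.of_forall fun n => ?_) (.of_forall fun n => ?_)
      (Continuous.intervalIntegrable (by fun_prop) _ _) ?_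
    · exact (hg.mul (hc n)).aestronglyMeasurable
    · refine .of_forall fun r _ => ?_
      rw [norm_mul, norm_eq_abs, norm_eq_abs]
      exact mul_le_mul_of_nonneg_left (hb n r) (abs_nonneg _)
    · exact .of_forall fun r _ => (hlim r).const_mul _
  unfold green
  exact (((key _ (by fun_prop) _ _).const_mul _).add
    ((key _ (by fun_prop) _ _).const_mul _)).div_const _

lemma mul_rpow_add_mul_le {A m q c s t K : ℝ} (h0 : 0 ≤ q) (hq : q < 1) (hm : 0 < m) (hA : |c| ≤ A)
    (hK : A * m ^ (q - 1) ≤ K) (hs : m ≤ s) (hst : s ≤ t) :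
    c * s ^ q + K * s ≤ c * t ^ q + K * t := by
  have hs0 : 0 < s := hm.trans_le hs
  have ht0 : 0 < t := hs0.trans_le hst
  have e (r : ℝ) (hr : 0 < r) : r ^ q = r * r ^ (q - 1) := by
    rw [rpow_sub_one hr.ne']; field_simp
  have h1 : t ^ (q - 1) ≤ s ^ (q - 1) := rpow_le_rpow_of_nonpos hs0 hst (by linarith)
  have h2 : s ^ (q - 1) ≤ m ^ (q - 1) := rpow_le_rpow_of_nonpos hm hs (by linarith)
  have h3 : t ^ q - s ^ q ≤ m ^ (q - 1) * (t - s) := by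
    rw [e t ht0, e s hs0]
    nlinarith
  have h5 : 0 ≤ A := (abs_nonneg c).trans hA
  have h6 : |c * (t ^ q - s ^ q)| ≤ K * (t - s) := by
    have h4 : 0 ≤ t ^ q - s ^ q := sub_nonneg.2 (rpow_le_rpow hs0.le hst h0)
    rw [abs_mul, abs_of_nonneg h4]
    calc |c| * (t ^ q - s ^ q) ≤ A * (m ^ (q - 1) * (t - s)) := by gcongr
      _ = A * m ^ (q - 1) * (t - s) := by ring
      _ ≤ K * (t - s) := mul_le_mul_of_nonneg_right hK (by linarith)
  have := neg_abs_le (c * (t ^ q - s ^ q))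
  linarith

theorem exists_neumannSolution_of_sub_super {L q : ℝ} (hL : 0 < L) (hq0 : 0 ≤ q) (hq1 : q < 1)
    {a y y' y'' z z' z'' : ℝ → ℝ} (ha : ContinuousOn a (Icc 0 L))
    (hy : IsC2 L y y' y'') (hz : IsC2 L z z' z'')
    (ypos : ∀ x ∈ Icc (0 : ℝ) L, 0 < y x) (hyz : ∀ x ∈ Icc (0 : ℝ) L, y x ≤ z x)
    (hy0 : 0 ≤ y' 0) (hyL : y' L ≤ 0) (hz0 : z' 0 ≤ 0) (hzL : 0 ≤ z' L)
    (hsub : ∀ x ∈ Icc (0 : ℝ) L, -y'' x ≤ a x * y x ^ q)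
    (hsup : ∀ x ∈ Icc (0 : ℝ) L, a x * z x ^ q ≤ -z'' x) :
    ∃ u u' u'' : ℝ → ℝ, NeumannSolution L q a u u' u'' ∧ ∀ x ∈ Icc (0 : ℝ) L, 0 < u x := by
  have hne : (Icc (0 : ℝ) L).Nonempty := nonempty_Icc.2 hL.le
  obtain ⟨A, hA⟩ := isCompact_Icc.exists_bound_of_continuousOn ha
  obtain ⟨x₀, hx₀, hmin⟩ := isCompact_Icc.exists_isMinOn hne hy.cont
  obtain ⟨x₁, hx₁, hmax⟩ := isCompact_Icc.exists_isMaxOn hne hz.cont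
  obtain ⟨m, hm, hmy⟩ : ∃ m, 0 < m ∧ ∀ x ∈ Icc (0 : ℝ) L, m ≤ y x :=
    ⟨y x₀, ypos x₀ hx₀, fun x hx => hmin hx⟩
  obtain ⟨M, hMz⟩ : ∃ M, ∀ x ∈ Icc (0 : ℝ) L, z x ≤ M := ⟨z x₁, fun x hx => hmax hx⟩
  have hA0 : 0 ≤ A := (norm_nonneg _).trans (hA x₀ hx₀)
  set b : ℝ → ℝ := fun x => a (clamp L x) with hb
  have hbc : Continuous b := ha.comp_clamp hL.le
  have hbA (x) : |b x| ≤ A := hA _ (clamp_mem hL.le x)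
  have hba {x} (hx : x ∈ Icc 0 L) : b x = a x := by simp only [hb, clamp_of_mem hx]
  set k : ℝ := A * m ^ (q - 1) + 1 with hk_def
  have hAm : 0 ≤ A * m ^ (q - 1) := by positivity
  have hk : 0 < k := by positivity
  have hkK : A * m ^ (q - 1) ≤ k ^ 2 := by nlinarith
  set F : (ℝ → ℝ) → ℝ → ℝ := fun w t => b t * w t ^ q + k ^ 2 * w t with hF
  have hFc {w : ℝ → ℝ} (hw : Continuous w) : Continuous (F w) := by
    have := hw.rpow_const (p := q) fun _ => Or.inr hq0
    simp only [hF]; fun_prop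
  have hFmono {v w : ℝ → ℝ} {t : ℝ} (h1 : m ≤ v t) (h2 : v t ≤ w t) : F v t ≤ F w t :=
    mul_rpow_add_mul_le hq0 hq1 hm (hbA t) hkK h1 h2
  set S : (ℝ → ℝ) → ℝ → ℝ := fun w x => green k L (F w) (clamp L x) with hS
  set y₀ : ℝ → ℝ := fun x => y (clamp L x) with hy₀
  set z₀ : ℝ → ℝ := fun x => z (clamp L x) with hz₀
  have hy₀c : Continuous y₀ := hy.cont.comp_clamp hL.le
  have hz₀c : Continuous z₀ := hz.cont.comp_clamp hL.le
  have hmy₀ (x) : m ≤ y₀ x := hmy _ (clamp_mem hL.le x)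
  have hzM₀ (x) : z₀ x ≤ M := hMz _ (clamp_mem hL.le x)
  have hSc {w : ℝ → ℝ} (hw : Continuous w) : Continuous (S w) :=
    (continuous_green fun s t => (hFc hw).intervalIntegrable s t).comp (continuous_clamp L)
  have hSmono {v w : ℝ → ℝ} (hv : Continuous v) (hw : Continuous w) (hmv : ∀ x, m ≤ v x)
      (hvw : ∀ x, v x ≤ w x) (x : ℝ) : S v x ≤ S w x :=
    green_mono hk hL (hFc hv).continuousOn (hFc hw).continuousOn
      (fun t _ => hFmono (hmv t) (hvw t)) (clamp_mem hL.le x)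
  have hySy (x) : y₀ x ≤ S y₀ x := by
    have hx := clamp_mem hL.le x
    refine (le_green hk hL hy hy0 hyL hx).trans (green_mono hk hL ?_ (hFc hy₀c).continuousOn
      (fun t ht => ?_) hx)
    · exact (hy.cont.const_smul (k ^ 2)).sub hy.cont''
    · have := hsub t ht
      simp only [hF, hba ht, hy₀, clamp_of_mem ht]
      linarith
  have hSzz (x) : S z₀ x ≤ z₀ x := by
    have hx := clamp_mem hL.le x
    refine le_trans (green_mono hk hL (hFc hz₀c).continuousOn ?_ (fun t ht => ?_) hx)
      (green_le hk hL hz hz0 hzL hx)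
    · exact (hz.cont.const_smul (k ^ 2)).sub hz.cont''
    · have := hsup t ht
      simp only [hF, hba ht, hz₀, clamp_of_mem ht]
      linarith
  have hyz₀ (x) : y₀ x ≤ z₀ x := hyz _ (clamp_mem hL.le x)
  set W : ℕ → ℝ → ℝ := fun n => S^[n] y₀ with hW
  have hWs (n) : W (n + 1) = S (W n) := Function.iterate_succ_apply' _ _ _
  have hWc (n) : Continuous (W n) := by
    induction n with
    | zero => exact hy₀c
    | succ n ih => rw [hWs]; exact hSc ih
  have hWb (n) : (∀ x, y₀ x ≤ W n x) ∧ ∀ x, W n x ≤ z₀ x := by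
    induction n with
    | zero => exact ⟨fun x => le_rfl, hyz₀⟩
    | succ n ih =>
      rw [hWs]
      exact ⟨fun x => (hySy x).trans (hSmono hy₀c (hWc n) hmy₀ ih.1 x),
        fun x => (hSmono (hWc n) hz₀c (fun x => (hmy₀ x).trans (ih.1 x)) ih.2 x).trans (hSzz x)⟩
  have hmW (n x) : m ≤ W n x := (hmy₀ x).trans ((hWb n).1 x)
  have hWM (n x) : W n x ≤ M := ((hWb n).2 x).trans (hzM₀ x)
  have hWstep (n) : ∀ x, W n x ≤ W (n + 1) x := by
    induction n with
    | zero => exact hySy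
    | succ n ih =>
      intro x
      have := hSmono (hWc n) (hWc (n + 1)) (hmW n) ih x
      rwa [← hWs, ← hWs] at this
  have hWmono (x) : Monotone fun n => W n x := monotone_nat_of_le_succ fun n => hWstep n x
  set u : ℝ → ℝ := fun x => ⨆ n, W n x with hu
  have hlim (x) : Filter.Tendsto (fun n => W n x) Filter.atTop (nhds (u x)) :=
    tendsto_atTop_ciSup (hWmono x) ⟨M, by rintro _ ⟨n, rfl⟩; exact hWM n x⟩
  have hmu (x) : m ≤ u x := ge_of_tendsto' (hlim x) fun n => hmW n x
  have huM (x) : u x ≤ M := le_of_tendsto' (hlim x) fun n => hWM n x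
  have humeas : Measurable u :=
    measurable_of_tendsto_metrizable (fun n => (hWc n).measurable) (tendsto_pi_nhds.2 hlim)
  have hFb {w : ℝ → ℝ} {t : ℝ} (h1 : m ≤ w t) (h2 : w t ≤ M) :
      |F w t| ≤ A * M ^ q + k ^ 2 * M := by
    have hw0 : 0 ≤ w t := hm.le.trans h1
    refine (abs_add_le _ _).trans ?_
    rw [abs_mul, abs_mul, abs_of_nonneg (rpow_nonneg hw0 q), abs_of_nonneg hw0,
      abs_of_nonneg (sq_nonneg k)]
    have := hbA t
    gcongr
  have hFlim (t) : Filter.Tendsto (fun n => F (W n) t) Filter.atTop (nhds (F u t)) :=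
    (((hlim t).rpow_const (Or.inr hq0)).const_mul _).add ((hlim t).const_mul _)
  have hFmeas : Measurable (F u) :=
    (hbc.measurable.mul (humeas.pow_const q)).add (humeas.const_mul _)
  have hFint (s t) : IntervalIntegrable (F u) MeasureTheory.volume s t :=
    (intervalIntegrable_const (c := A * M ^ q + k ^ 2 * M)).mono_fun'
      hFmeas.aestronglyMeasurable (.of_forall fun x => hFb (hmu x) (huM x))
  have hfix (x) : u x = S u x := by
    refine tendsto_nhds_unique ((hlim x).comp (Filter.tendsto_add_atTop_nat 1)) ?_
    have := tendsto_green (k := k) (L := L) (fun n => hFc (hWc n))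
      (fun n t => hFb (hmW n t) (hWM n t)) hFlim (clamp L x)
    refine this.congr fun n => ?_
    simp only [Function.comp_apply, hWs, hS]
  have huc : Continuous u := by
    rw [show u = S u from funext hfix]
    exact (continuous_green hFint).comp (continuous_clamp L)
  have hug {x} (hx : x ∈ Icc 0 L) : green k L (F u) x = u x := by
    rw [hfix x]; simp only [hS, clamp_of_mem hx]
  have hgc : Continuous (green k L (F u)) := continuous_green hFint
  refine ⟨green k L (F u), greenDeriv k L (F u), fun x => k ^ 2 * green k L (F u) x - F u x,
    ⟨fun x _ => (hasDerivAt_green hk hL (hFc huc) x).hasDerivWithinAt,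
      fun x _ => (hasDerivAt_greenDeriv hk hL (hFc huc) x).hasDerivWithinAt,
      ((hgc.const_smul (k ^ 2)).sub (hFc huc)).continuousOn, fun x hx => ?_,
      greenDeriv_zero _ _ _, greenDeriv_right _ _ _, fun x hx => ?_⟩, fun x hx => ?_⟩
  · rw [hug hx]; exact hm.le.trans (hmu x)
  · change -(k ^ 2 * green k L (F u) x - F u x) = a x * green k L (F u) x ^ q
    rw [hug hx]
    simp only [hF, hba hx]
    ring
  · rw [hug hx]; exact hm.trans_le (hmu x)

/-- `v` is a positive subsolution of `-v'' = a + γ v'² / v` with Neumann boundary conditions.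
This is the equation that `-u'' = a u ^ q` becomes under `v = u ^ (1 - q) / (1 - q)`, with
`γ = q / (1 - q)`. -/
structure IsSub (L γ : ℝ) (a v v' v'' : ℝ → ℝ) : Prop where
  isC2 : IsC2 L v v' v''
  pos : ∀ x ∈ Icc (0 : ℝ) L, 0 < v x
  left : 0 ≤ v' 0
  right : v' L ≤ 0
  le : ∀ x ∈ Icc (0 : ℝ) L, -v'' x ≤ a x + γ * (v' x ^ 2 / v x)

lemma IsSub.mono {L γ δ : ℝ} {a v v' v'' : ℝ → ℝ} (h : IsSub L γ a v v' v'') (hγ : γ ≤ δ) :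
    IsSub L δ a v v' v'' where
  __ := h
  le x hx := (h.le x hx).trans (by have := h.pos x hx; gcongr)

lemma IsC2.rpow {L β : ℝ} (hβ : 0 < β) {v v' v'' : ℝ → ℝ} (h : IsC2 L v v' v'')
    (hv : ∀ x ∈ Icc (0 : ℝ) L, 0 < v x) :
    IsC2 L (fun x => (v x / β) ^ β) (fun x => (v x / β) ^ (β - 1) * v' x)
      (fun x => (v x / β) ^ (β - 1) * (v'' x + (β - 1) * (v' x ^ 2 / v x))) := by
  have hpos {x} (hx : x ∈ Icc (0 : ℝ) L) : 0 < v x / β := div_pos (hv x hx) hβ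
  refine ⟨fun x hx => ?_, fun x hx => ?_, ?_⟩
  · refine (((h.hasDeriv x hx).div_const β).rpow_const (p := β)
      (Or.inl (hpos hx).ne')).congr_deriv ?_
    field_simp
  · refine ((((h.hasDeriv x hx).div_const β).rpow_const (p := β - 1)
      (Or.inl (hpos hx).ne')).mul (h.hasDeriv' x hx)).congr_deriv ?_
    have := hv x hx
    rw [rpow_sub_one (hpos hx).ne' (β - 1)]
    field_simp
    ring
  · have hne : ∀ x ∈ Icc (0 : ℝ) L, v x ≠ 0 := fun x hx => (hv x hx).ne'
    exact ((h.cont.div_const β).rpow_const fun x hx => Or.inl (hpos hx).ne').mul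
      (h.cont''.add (((h.cont'.pow 2).div h.cont hne).const_smul (β - 1)))

lemma exists_supersolution {L : ℝ} (hL : 0 < L) {a : ℝ → ℝ} (ha : ContinuousOn a (Icc 0 L))
    (hneg : (∫ x in (0 : ℝ)..L, a x) < 0) {γ : ℝ} (hγ : 0 ≤ γ) (C : ℝ) :
    ∃ v v' v'' : ℝ → ℝ, IsC2 L v v' v'' ∧ (∀ x ∈ Icc (0 : ℝ) L, 0 < v x ∧ C ≤ v x) ∧
      v' 0 = 0 ∧ v' L = 0 ∧
      ∀ x ∈ Icc (0 : ℝ) L, a x + γ * (v' x ^ 2 / v x) ≤ -v'' x := by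
  set b : ℝ → ℝ := fun x => a (clamp L x) with hb
  have hbc : Continuous b := ha.comp_clamp hL.le
  have hba {x} (hx : x ∈ Icc 0 L) : b x = a x := by simp only [hb, clamp_of_mem hx]
  obtain ⟨η, hη, hηL⟩ : ∃ η : ℝ, 0 < η ∧ (∫ x in (0 : ℝ)..L, a x) = -η * L :=
    ⟨-(∫ x in (0 : ℝ)..L, a x) / L, div_pos (neg_pos.2 hneg) hL, by field_simp⟩
  set p : ℝ → ℝ := fun x => ∫ t in (0 : ℝ)..x, (-η - b t) with hp
  have hpd (x) : HasDerivAt p (-η - b x) x := hasDerivAt_integral_right (by fun_prop) x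
  have hpc : Continuous p := continuous_iff_continuousAt.2 fun x => (hpd x).continuousAt
  set w : ℝ → ℝ := fun x => ∫ t in (0 : ℝ)..x, p t with hw
  have hwd (x) : HasDerivAt w (p x) x := hasDerivAt_integral_right hpc x
  have hwc : Continuous w := continuous_iff_continuousAt.2 fun x => (hwd x).continuousAt
  obtain ⟨B, hB⟩ := isCompact_Icc.exists_bound_of_continuousOn (s := Icc 0 L) hpc.continuousOn
  obtain ⟨D, hD⟩ := isCompact_Icc.exists_bound_of_continuousOn (s := Icc 0 L) hwc.continuousOn
  set c : ℝ := D + |C| + 1 + γ * B ^ 2 / η with hc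
  have hcw {x} (hx : x ∈ Icc 0 L) : |C| + 1 + γ * B ^ 2 / η ≤ c + w x := by
    have := (abs_le.1 (hD x hx)).1
    linarith
  have hnn : 0 ≤ γ * B ^ 2 / η := by positivity
  have hcpos {x} (hx : x ∈ Icc 0 L) : 0 < c + w x := by
    have := hcw hx
    have := abs_nonneg C
    linarith
  refine ⟨fun x => c + w x, p, fun x => -η - b x, ⟨fun x _ => ((hwd x).const_add c).hasDerivWithinAt,
    fun x _ => (hpd x).hasDerivWithinAt, by fun_prop⟩, fun x hx => ⟨hcpos hx, ?_⟩, ?_, ?_,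
    fun x hx => ?_⟩
  · have := hcw hx
    have := le_abs_self C
    linarith
  · simp [hp]
  · simp only [hp]
    rw [intervalIntegral.integral_sub (by simp) (hbc.intervalIntegrable _ _)]
    have : ∫ t in (0 : ℝ)..L, b t = ∫ t in (0 : ℝ)..L, a t := by
      refine intervalIntegral.integral_congr fun t ht => hba ?_
      rwa [uIcc_of_le hL.le] at ht
    rw [this, hηL, intervalIntegral.integral_const, smul_eq_mul]
    ring
  · have h1 : γ * (p x ^ 2 / (c + w x)) ≤ η := by
      rw [← mul_div_assoc, div_le_iff₀ (hcpos hx)]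
      have h2 : p x ^ 2 ≤ B ^ 2 := sq_le_sq' (abs_le.1 (hB x hx)).1 (abs_le.1 (hB x hx)).2
      have h3 : γ * B ^ 2 / η ≤ c + w x := by
        have := hcw hx
        have := abs_nonneg C
        linarith
      rw [div_le_iff₀ hη] at h3
      nlinarith
    rw [← hba hx]
    linarith

theorem IsSub.exists_neumannSolution {L : ℝ} (hL : 0 < L) {a : ℝ → ℝ}
    (ha : ContinuousOn a (Icc 0 L)) (hneg : (∫ x in (0 : ℝ)..L, a x) < 0) {q : ℝ} (hq0 : 0 ≤ q)
    (hq1 : q < 1) {v v' v'' : ℝ → ℝ} (h : IsSub L (q / (1 - q)) a v v' v'') :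
    ∃ u u' u'' : ℝ → ℝ, NeumannSolution L q a u u' u'' ∧ ∀ x ∈ Icc (0 : ℝ) L, 0 < u x := by
  have hq : 0 < 1 - q := by linarith
  obtain ⟨C, hC⟩ := isCompact_Icc.exists_bound_of_continuousOn h.isC2.cont
  obtain ⟨z, z', z'', hz, hzC, hz0, hzL, hsup⟩ :=
    exists_supersolution hL ha hneg (div_nonneg hq0 hq.le) C
  set β : ℝ := (1 - q)⁻¹ with hβ_def
  have hβ : 0 < β := inv_pos.2 hq
  have hβ1 : β - 1 = q / (1 - q) := by rw [hβ_def]; field_simp; ring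
  have hpow {t : ℝ} (ht : 0 < t) : ((t / β) ^ β) ^ q = (t / β) ^ (β - 1) := by
    rw [← rpow_mul (div_pos ht hβ).le, hβ1, hβ_def, inv_mul_eq_div]
  have hcoef {t : ℝ} (ht : 0 < t) : 0 < (t / β) ^ (β - 1) := rpow_pos_of_pos (div_pos ht hβ) _
  have hzpos : ∀ x ∈ Icc (0 : ℝ) L, 0 < z x := fun x hx => (hzC x hx).1
  have h0 : (0 : ℝ) ∈ Icc 0 L := ⟨le_rfl, hL.le⟩
  have h1 : L ∈ Icc 0 L := ⟨hL.le, le_rfl⟩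
  refine exists_neumannSolution_of_sub_super hL hq0 hq1 ha (h.isC2.rpow hβ h.pos)
    (hz.rpow hβ hzpos) (fun x hx => rpow_pos_of_pos (div_pos (h.pos x hx) hβ) _)
    (fun x hx => ?_) ?_ ?_ ?_ ?_ (fun x hx => ?_) (fun x hx => ?_)
  · have := h.pos x hx
    have : v x ≤ z x := (le_abs_self _).trans ((hC x hx).trans (hzC x hx).2)
    gcongr
  · exact mul_nonneg (hcoef (h.pos 0 h0)).le h.left
  · exact mul_nonpos_of_nonneg_of_nonpos (hcoef (h.pos L h1)).le h.right
  · simp [hz0]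
  · simp [hzL]
  · rw [hpow (h.pos x hx), hβ1]
    have := mul_le_mul_of_nonneg_left (h.le x hx) (hcoef (h.pos x hx)).le
    rw [hβ1] at this
    linarith
  · rw [hpow (hzpos x hx), hβ1]
    have := mul_le_mul_of_nonneg_left (hsup x hx) (hcoef (hzpos x hx)).le
    rw [hβ1] at this
    linarith

lemma NeumannSolution.isC2_rpow {L q : ℝ} (hq1 : q < 1) {a u u' u'' : ℝ → ℝ}
    (h : NeumannSolution L q a u u' u'') (hu : ∀ x ∈ Icc (0 : ℝ) L, 0 < u x) :
    ∃ v v' v'' : ℝ → ℝ, IsC2 L v v' v'' ∧ (∀ x ∈ Icc (0 : ℝ) L, 0 < v x) ∧ v' 0 = 0 ∧ v' L = 0 ∧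
      ∀ x ∈ Icc (0 : ℝ) L, -v'' x = a x + q / (1 - q) * (v' x ^ 2 / v x) := by
  obtain ⟨hd, hd', hc, -, h0, hL, heq⟩ := h
  have hq : 0 < 1 - q := by linarith
  have hC2 : IsC2 L u u' u'' := ⟨hd, hd', hc⟩
  refine ⟨fun x => u x ^ (1 - q) / (1 - q), fun x => u x ^ (-q) * u' x,
    fun x => u x ^ (-q) * u'' x - q * u x ^ (-q - 1) * u' x ^ 2,
    ⟨fun x hx => ?_, fun x hx => ?_, ?_⟩,
    fun x hx => div_pos (rpow_pos_of_pos (hu x hx) _) hq, by simp [h0], by simp [hL],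
    fun x hx => ?_⟩
  · refine (((hd x hx).rpow_const (p := 1 - q) (Or.inl (hu x hx).ne')).div_const
      (1 - q)).congr_deriv ?_
    rw [show 1 - q - 1 = -q by ring]
    field_simp
  · refine (((hd x hx).rpow_const (p := -q) (Or.inl (hu x hx).ne')).mul (hd' x hx)).congr_deriv ?_
    ring
  · have hr (r : ℝ) : ContinuousOn (fun x => u x ^ r) (Icc 0 L) :=
      hC2.cont.rpow_const fun x hx => Or.inl (hu x hx).ne'
    exact ((hr _).mul hc).sub ((continuousOn_const.mul (hr _)).mul (hC2.cont'.pow 2))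
  · have hux := hu x hx
    have e := heq x hx
    have e1 : u x ^ (-q) = (u x ^ q)⁻¹ := rpow_neg hux.le q
    have e2 : u x ^ (-q - 1) = (u x ^ q)⁻¹ / u x := by rw [rpow_sub_one hux.ne', e1]
    have e3 : u x ^ (1 - q) = u x / u x ^ q := by rw [rpow_sub hux, rpow_one]
    have hp : 0 < u x ^ q := rpow_pos_of_pos hux q
    beta_reduce
    rw [show u'' x = -(a x * u x ^ q) by linarith, e1, e2, e3]
    field_simp
    ring

lemma IsC2.comp_clamp {L : ℝ} {v v' v'' : ℝ → ℝ} (h : IsC2 L v v' v'') :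
    IsC2 L (fun x => v (clamp L x)) (fun x => v' (clamp L x)) (fun x => v'' (clamp L x)) := by
  have e (f : ℝ → ℝ) : ∀ x ∈ Icc (0 : ℝ) L, f (clamp L x) = f x := fun x hx => by
    rw [clamp_of_mem hx]
  refine ⟨fun x hx => ?_, fun x hx => ?_, h.cont''.congr (e v'')⟩
  · rw [e v' x hx]; exact (h.hasDeriv x hx).congr (e v) (e v x hx)
  · rw [e v'' x hx]; exact (h.hasDeriv' x hx).congr (e v') (e v' x hx)

/-- A Neumann perturbation direction on which the linearization of `-v'' - γ v'² / v` is at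
least `1`. -/
lemma exists_linearized_pos {L γ : ℝ} (hL : 0 < L) (hγ : 0 < γ) {v v' v'' : ℝ → ℝ}
    (h : IsC2 L v v' v'') (hvc : Continuous v) (hvc' : Continuous v') (hv : ∀ x, 0 < v x)
    {x₀ : ℝ} (hx₀ : x₀ ∈ Icc 0 L) (hne : v' x₀ ≠ 0) :
    ∃ φ φ' φ'' : ℝ → ℝ, IsC2 L φ φ' φ'' ∧ φ' 0 = 0 ∧ φ' L = 0 ∧
      ∀ x ∈ Icc (0 : ℝ) L,
        1 ≤ -φ'' x - 2 * γ * (v' x / v x) * φ' x + γ * (v' x / v x) ^ 2 * φ x := by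
  have hrp (e : ℝ) : Continuous fun x => v x ^ e := hvc.rpow_const fun x => Or.inl (hv x).ne'
  have hrpos (e x : ℝ) : 0 < v x ^ e := rpow_pos_of_pos (hv x) e
  have hrc : Continuous fun x => v' x / v x := hvc'.div hvc fun x => (hv x).ne'
  have hp1 := hrp (2 * γ)
  have hp2 := hrp (-(2 * γ))
  have hI0 : 0 < ∫ x in (0 : ℝ)..L, v x ^ (2 * γ) :=
    intervalIntegral.integral_pos hL hp1.continuousOn (fun x _ => (hrpos _ x).le)
      ⟨0, ⟨le_rfl, hL.le⟩, hrpos _ 0⟩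
  have hI2 : 0 < ∫ x in (0 : ℝ)..L, v x ^ (2 * γ) * (v' x / v x) ^ 2 := by
    refine intervalIntegral.integral_pos hL (by fun_prop)
      (fun x _ => mul_nonneg (hrpos _ x).le (sq_nonneg _)) ⟨x₀, hx₀, ?_⟩
    have := div_ne_zero hne (hv x₀).ne'
    have := hrpos (2 * γ) x₀
    positivity
  obtain ⟨κ, hκ⟩ : ∃ κ : ℝ, (∫ x in (0 : ℝ)..L, v x ^ (2 * γ)) -
      κ * (∫ x in (0 : ℝ)..L, v x ^ (2 * γ) * (v' x / v x) ^ 2) = 0 :=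
    ⟨(∫ x in (0 : ℝ)..L, v x ^ (2 * γ)) /
      (∫ x in (0 : ℝ)..L, v x ^ (2 * γ) * (v' x / v x) ^ 2), by rw [div_mul_cancel₀ _ hI2.ne', sub_self]⟩
  set P : ℝ → ℝ := fun x => ∫ t in (0 : ℝ)..x,
    (v t ^ (2 * γ) - κ * (v t ^ (2 * γ) * (v' t / v t) ^ 2)) with hP
  have hPd (x) : HasDerivAt P (v x ^ (2 * γ) - κ * (v x ^ (2 * γ) * (v' x / v x) ^ 2)) x :=
    hasDerivAt_integral_right (by fun_prop) x
  have hPc : Continuous P := continuous_iff_continuousAt.2 fun x => (hPd x).continuousAt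
  have hP0 : P 0 = 0 := by simp [hP]
  have hPL : P L = 0 := by
    simp only [hP]
    rw [intervalIntegral.integral_sub (hp1.intervalIntegrable _ _)
      (Continuous.intervalIntegrable (by fun_prop) _ _), intervalIntegral.integral_const_mul, hκ]
  set ψ' : ℝ → ℝ := fun x => -(P x * v x ^ (-(2 * γ))) with hψ'
  have hψc' : Continuous ψ' := by fun_prop
  set ψ : ℝ → ℝ := fun x => ∫ t in (0 : ℝ)..x, ψ' t with hψ
  have hψd (x) : HasDerivAt ψ (ψ' x) x := hasDerivAt_integral_right hψc' x
  have hψc : Continuous ψ := continuous_iff_continuousAt.2 fun x => (hψd x).continuousAt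
  obtain ⟨D, hD⟩ := isCompact_Icc.exists_bound_of_continuousOn (s := Icc 0 L) hψc.continuousOn
  refine ⟨fun x => κ / γ + D + ψ x, ψ',
    fun x => -1 + κ * (v' x / v x) ^ 2 - 2 * γ * (v' x / v x) * ψ' x,
    ⟨fun x _ => ((hψd x).const_add _).hasDerivWithinAt, fun x hx => ?_, by fun_prop⟩,
    by simp [hψ', hP0], by simp [hψ', hPL], fun x hx => ?_⟩
  · refine ((hPd x).hasDerivWithinAt.mul ((h.hasDeriv x hx).rpow_const (p := -(2 * γ))
      (Or.inl (hv x).ne'))).neg.congr_deriv ?_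
    have := hrpos (2 * γ) x
    have := hv x
    simp only [hψ']
    rw [rpow_sub_one (hv x).ne', rpow_neg (hv x).le]
    field_simp
    ring
  · have h1 := (abs_le.1 (hD x hx)).1
    have h2 : κ ≤ γ * (κ / γ + D + ψ x) := by
      calc κ = γ * (κ / γ) := by field_simp
        _ ≤ _ := mul_le_mul_of_nonneg_left (by linarith) hγ.le
    have h3 := mul_le_mul_of_nonneg_right h2 (sq_nonneg (v' x / v x))
    beta_reduce
    linarith

theorem exists_isSub_lt {L γ : ℝ} (hL : 0 < L) (hγ : 0 < γ) {a : ℝ → ℝ}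
    (hneg : (∫ x in (0 : ℝ)..L, a x) < 0) {v v' v'' : ℝ → ℝ}
    (h : IsC2 L v v' v'') (hv : ∀ x ∈ Icc (0 : ℝ) L, 0 < v x) (h0 : v' 0 = 0) (h1 : v' L = 0)
    (heq : ∀ x ∈ Icc (0 : ℝ) L, -v'' x = a x + γ * (v' x ^ 2 / v x)) :
    ∃ δ w w' w'', 0 < δ ∧ δ < γ ∧ IsSub L δ a w w' w'' := by
  obtain ⟨x₀, hx₀, hne⟩ : ∃ x ∈ Icc (0 : ℝ) L, v' x ≠ 0 := by
    by_contra! hall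
    have e : ∫ x in (0 : ℝ)..L, v'' x = v' L - v' 0 :=
      integral_eq_sub_of_hasDerivWithinAt_Icc le_rfl hL.le le_rfl h.hasDeriv' h.cont''
    have e2 : ∫ x in (0 : ℝ)..L, v'' x = ∫ x in (0 : ℝ)..L, -a x := by
      refine intervalIntegral.integral_congr fun x hx => ?_
      rw [uIcc_of_le hL.le] at hx
      have := heq x hx
      rw [hall x hx] at this
      norm_num at this
      linarith
    rw [h0, h1, e2, intervalIntegral.integral_neg] at e
    linarith
  obtain ⟨φ, φ', φ'', hφ, hφ0, hφL, hlin⟩ := exists_linearized_pos hL hγ h.comp_clamp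
    (h.cont.comp_clamp hL.le) (h.cont'.comp_clamp hL.le) (fun x => hv _ (clamp_mem hL.le x)) hx₀
    (by rwa [clamp_of_mem hx₀])
  obtain ⟨D, hD⟩ := isCompact_Icc.exists_bound_of_continuousOn hφ.cont
  obtain ⟨x₁, hx₁, hmin⟩ := isCompact_Icc.exists_isMinOn (nonempty_Icc.2 hL.le) h.cont
  have hm : 0 < v x₁ := hv x₁ hx₁
  have hD0 : 0 ≤ D := (norm_nonneg _).trans (hD x₁ hx₁)
  set ε : ℝ := v x₁ / (D + 1) with hε_def
  have hε : 0 < ε := by positivity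
  have hwpos : ∀ x ∈ Icc (0 : ℝ) L, 0 < v x - ε * φ x := fun x hx => by
    have h2 : φ x ≤ D := (le_abs_self _).trans (hD x hx)
    have h3 : v x₁ ≤ v x := hmin hx
    have h4 : ε * (D + 1) = v x₁ := by rw [hε_def]; field_simp
    nlinarith
  have hw : IsC2 L (fun x => v x - ε * φ x) (fun x => v' x - ε * φ' x)
      (fun x => v'' x - ε * φ'' x) :=
    ⟨fun x hx => (h.hasDeriv x hx).sub ((hφ.hasDeriv x hx).const_mul ε),
      fun x hx => (h.hasDeriv' x hx).sub ((hφ.hasDeriv' x hx).const_mul ε),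
      h.cont''.sub (hφ.cont''.const_smul ε)⟩
  have hquot : ContinuousOn (fun x => (v' x - ε * φ' x) ^ 2 / (v x - ε * φ x)) (Icc 0 L) :=
    (hw.cont'.pow 2).div hw.cont fun x hx => (hwpos x hx).ne'
  obtain ⟨B, hB⟩ := isCompact_Icc.exists_bound_of_continuousOn hquot
  have hB0 : 0 ≤ B := (norm_nonneg _).trans (hB x₁ hx₁)
  have hstrict : ∀ x ∈ Icc (0 : ℝ) L, -(v'' x - ε * φ'' x) + ε ≤
      a x + γ * ((v' x - ε * φ' x) ^ 2 / (v x - ε * φ x)) := fun x hx => by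
    have hl := hlin x hx
    rw [clamp_of_mem hx] at hl
    set r := v' x / v x with hr
    have hvr : v' x = r * v x := by rw [hr]; field_simp [(hv x hx).ne']
    have hconv : 2 * r * (v' x - ε * φ' x) - r ^ 2 * (v x - ε * φ x) ≤
        (v' x - ε * φ' x) ^ 2 / (v x - ε * φ x) := by
      rw [le_div_iff₀ (hwpos x hx)]
      nlinarith [sq_nonneg (v' x - ε * φ' x - r * (v x - ε * φ x))]
    have e := heq x hx
    have e2 : v' x ^ 2 / v x = r ^ 2 * v x := by
      rw [hvr]; field_simp [(hv x hx).ne']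
    rw [e2] at e
    have h5 := mul_le_mul_of_nonneg_left hconv hγ.le
    have h6 := mul_le_mul_of_nonneg_left hl hε.le
    have e3 : γ * (2 * r * (v' x - ε * φ' x) - r ^ 2 * (v x - ε * φ x)) =
      γ * (r ^ 2 * v x) - ε * (2 * γ * r * φ' x - γ * r ^ 2 * φ x) := by rw [hvr]; ring
    linarith
  refine ⟨max (γ / 2) (γ - ε / (B + 1)), _, _, _, lt_max_of_lt_left (by positivity),
    max_lt (by linarith) (sub_lt_self _ (by positivity)), hw, hwpos, by simp [h0, hφ0],
    by simp [h1, hφL], fun x hx => ?_⟩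
  have h2 := hstrict x hx
  have h3 : (v' x - ε * φ' x) ^ 2 / (v x - ε * φ x) ≤ B + 1 :=
    (le_abs_self _).trans ((hB x hx).trans (by linarith))
  have h4 : 0 ≤ (v' x - ε * φ' x) ^ 2 / (v x - ε * φ x) :=
    div_nonneg (sq_nonneg _) (hwpos x hx).le
  have h5 := mul_le_mul_of_nonneg_right (le_max_right (γ / 2) (γ - ε / (B + 1))) h4
  have h6 : ε / (B + 1) * ((v' x - ε * φ' x) ^ 2 / (v x - ε * φ x)) ≤ ε := by
    calc _ ≤ ε / (B + 1) * (B + 1) := by gcongr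
      _ = ε := by field_simp
  linarith

lemma exists_Icc_pos {L : ℝ} (hL : 0 < L) {a : ℝ → ℝ} (ha : ContinuousOn a (Icc 0 L))
    (hpos : ∃ x ∈ Icc (0 : ℝ) L, 0 < a x) :
    ∃ α β a₀ : ℝ, 0 ≤ α ∧ α < β ∧ β ≤ L ∧ 0 < a₀ ∧ ∀ x ∈ Icc α β, a₀ ≤ a x := by
  obtain ⟨x₀, hx₀, hax₀⟩ := hpos
  have hbc : Continuous fun x => a (clamp L x) := ha.comp_clamp hL.le
  have hcl : x₀ ∈ closure (Ioo 0 L) := by rwa [closure_Ioo hL.ne]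
  have hopen : IsOpen {x | a x₀ / 2 < a (clamp L x)} := isOpen_lt continuous_const hbc
  obtain ⟨x₁, hx₁, hx₁'⟩ := mem_closure_iff.1 hcl _ hopen
    (by simp only [mem_ofPred_eq, clamp_of_mem hx₀]; linarith)
  obtain ⟨r, hr, hball⟩ := Metric.isOpen_iff.1 (hopen.inter isOpen_Ioo) x₁ ⟨hx₁, hx₁'⟩
  have hsub : ∀ x ∈ Icc (x₁ - r / 2) (x₁ + r / 2),
      a x₀ / 2 < a (clamp L x) ∧ x ∈ Ioo 0 L := fun x hx =>
    hball (by rw [Metric.mem_ball, dist_eq, abs_lt]; constructor <;> linarith [hx.1, hx.2])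
  refine ⟨x₁ - r / 2, x₁ + r / 2, a x₀ / 2, (hsub _ ⟨le_rfl, by linarith⟩).2.1.le, by linarith,
    (hsub _ ⟨by linarith, le_rfl⟩).2.2.le, by linarith, fun x hx => ?_⟩
  obtain ⟨h1, h2⟩ := hsub x hx
  rw [clamp_of_mem (Ioo_subset_Icc_self h2)] at h1
  exact h1.le

lemma deriv_smoothTransition_of_neg {y : ℝ} (hy : y < 0) : deriv smoothTransition y = 0 := by
  have : smoothTransition =ᶠ[nhds y] fun _ => 0 :=
    (eventually_lt_nhds hy).mono fun z hz => smoothTransition.zero_of_nonpos hz.le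
  rw [this.deriv_eq, deriv_const]

lemma deriv_smoothTransition_of_one_lt {y : ℝ} (hy : 1 < y) : deriv smoothTransition y = 0 := by
  have : smoothTransition =ᶠ[nhds y] fun _ => 1 :=
    (eventually_gt_nhds hy).mono fun z hz => smoothTransition.one_of_one_le hz.le
  rw [this.deriv_eq, deriv_const]

/-- The Riccati inequality `ρ' + ρ² + lam * a > 0`, which says that `exp (∫ ρ)` is a strict
subsolution of `-φ'' = lam * a * φ`, holds for some large `lam`. -/
lemma exists_riccati {L : ℝ} (hL : 0 < L) {a : ℝ → ℝ} (ha : ContinuousOn a (Icc 0 L))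
    (hpos : ∃ x ∈ Icc (0 : ℝ) L, 0 < a x) :
    ∃ (lam δ : ℝ) (ρ ρ' : ℝ → ℝ), 0 < lam ∧ 0 < δ ∧ (∀ x, HasDerivAt ρ (ρ' x) x) ∧
      Continuous ρ' ∧ 0 ≤ ρ 0 ∧ ρ L ≤ 0 ∧
      ∀ x ∈ Icc (0 : ℝ) L, δ ≤ ρ' x + ρ x ^ 2 + lam * a x := by
  obtain ⟨α, β, a₀, hα, hαβ, hβ, ha₀, haJ⟩ := exists_Icc_pos hL ha hpos
  obtain ⟨A, hA0, hA⟩ : ∃ A, 0 < A ∧ ∀ x ∈ Icc (0 : ℝ) L, |a x| ≤ A := by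
    obtain ⟨A, hA⟩ := isCompact_Icc.exists_bound_of_continuousOn ha
    exact ⟨max A 1, by positivity, fun x hx => (hA x hx).trans (le_max_left _ _)⟩
  have hlen : 0 < β - α := by linarith
  set s : ℝ → ℝ := deriv smoothTransition with hs
  have hsd (y) : HasDerivAt smoothTransition (s y) y :=
    ((smoothTransition.contDiff (n := 1)).differentiable (by norm_num) y).hasDerivAt
  have hsc : Continuous s := (smoothTransition.contDiff (n := 1)).continuous_deriv (by norm_num)
  set τ : ℝ → ℝ := fun x => (x - α) / (β - α) with hτ
  have hτc : Continuous τ := by fun_prop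
  obtain ⟨D, hD⟩ := isCompact_Icc.exists_bound_of_continuousOn (s := Icc 0 L)
    (f := fun x => 2 * (s (τ x) * (1 / (β - α)))) (by fun_prop)
  have hD0 : 0 ≤ D := (norm_nonneg _).trans (hD 0 ⟨le_rfl, hL.le⟩)
  set k : ℝ := (D + 1) * (2 * A) / a₀ with hk_def
  have hk : 0 < k := by positivity
  have hka : k * a₀ = (D + 1) * (2 * A) := by rw [hk_def]; field_simp
  have hout {x : ℝ} (hx : x ∈ Icc 0 L) : k ^ 2 / 2 ≤ k ^ 2 + k ^ 2 / (2 * A) * a x := by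
    have h1 : -A ≤ a x := (abs_le.1 (hA x hx)).1
    have h2 : k ^ 2 / (2 * A) * -A ≤ k ^ 2 / (2 * A) * a x := by gcongr
    have h3 : k ^ 2 / (2 * A) * -A = -(k ^ 2 / 2) := by field_simp
    linarith
  refine ⟨k ^ 2 / (2 * A), min k (k ^ 2 / 2), fun x => k * (1 - 2 * smoothTransition (τ x)),
    fun x => -(k * (2 * (s (τ x) * (1 / (β - α))))), by positivity, by positivity, fun x => ?_,
    by fun_prop, ?_, ?_, fun x hx => ?_⟩
  · have h1 : HasDerivAt τ (1 / (β - α)) x := ((hasDerivAt_id x).sub_const α).div_const _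
    refine (((((hsd (τ x)).comp x h1).const_mul 2).const_sub 1).const_mul k).congr_deriv ?_
    ring
  · have : τ 0 ≤ 0 := div_nonpos_of_nonpos_of_nonneg (by linarith) hlen.le
    simp [smoothTransition.zero_of_nonpos this, hk.le]
  · have : 1 ≤ τ L := by rw [hτ]; exact (one_le_div hlen).2 (by linarith)
    beta_reduce
    rw [smoothTransition.one_of_one_le this]
    linarith
  · beta_reduce
    rcases lt_or_ge x α with h | h
    · have h1 : τ x < 0 := div_neg_of_neg_of_pos (by linarith) hlen
      rw [hs, deriv_smoothTransition_of_neg h1, smoothTransition.zero_of_nonpos h1.le]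
      refine (min_le_right _ _).trans ((hout hx).trans (le_of_eq ?_))
      ring
    rcases lt_or_ge β x with h' | h'
    · have h1 : 1 < τ x := (one_lt_div hlen).2 (by linarith)
      rw [hs, deriv_smoothTransition_of_one_lt h1, smoothTransition.one_of_one_le h1.le]
      refine (min_le_right _ _).trans ((hout hx).trans (le_of_eq ?_))
      ring
    · have h1 := (abs_le.1 (hD x hx)).2
      have h2 : k ^ 2 / (2 * A) * a₀ ≤ k ^ 2 / (2 * A) * a x := by
        have := haJ x ⟨h, h'⟩
        gcongr
      have h3 : k ^ 2 / (2 * A) * a₀ = k * (D + 1) := by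
        rw [show k ^ 2 / (2 * A) * a₀ = k * (k * a₀) / (2 * A) by ring, hka]
        field_simp
      have h4 := mul_le_mul_of_nonneg_left h1 hk.le
      have h5 := sq_nonneg (k * (1 - 2 * smoothTransition (τ x)))
      refine (min_le_left _ _).trans ?_
      linarith

theorem exists_isSub {L : ℝ} (hL : 0 < L) {a : ℝ → ℝ} (ha : ContinuousOn a (Icc 0 L))
    (hpos : ∃ x ∈ Icc (0 : ℝ) L, 0 < a x) :
    ∃ γ v v' v'', 0 < γ ∧ IsSub L γ a v v' v'' := by
  obtain ⟨lam, δ, ρ, ρ', hlam, hδ, hρd, hρc', hρ0, hρL, hric⟩ := exists_riccati hL ha hpos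
  have hρc : Continuous ρ := continuous_iff_continuousAt.2 fun x => (hρd x).continuousAt
  set w : ℝ → ℝ := fun x => ∫ t in (0 : ℝ)..x, ρ t with hw
  have hwd (x) : HasDerivAt w (ρ x) x := hasDerivAt_integral_right hρc x
  have hwc : Continuous w := continuous_iff_continuousAt.2 fun x => (hwd x).continuousAt
  obtain ⟨A, hA⟩ := isCompact_Icc.exists_bound_of_continuousOn ha
  obtain ⟨B, hB⟩ := isCompact_Icc.exists_bound_of_continuousOn (s := Icc 0 L) hwc.continuousOn
  have h0 : (0 : ℝ) ∈ Icc 0 L := ⟨le_rfl, hL.le⟩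
  have hA0 : 0 ≤ A := (norm_nonneg _).trans (hA 0 h0)
  have hB0 : 0 ≤ B := (norm_nonneg _).trans (hB 0 h0)
  have hE0 : 0 ≤ lam * A * (2 * B) / δ := by positivity
  set θ : ℝ := (B + lam * A * (2 * B) / δ + 2)⁻¹ with hθ_def
  have hθ : 0 < θ := by positivity
  have hθe : θ * (B + lam * A * (2 * B) / δ + 2) = 1 := inv_mul_cancel₀ (by positivity)
  have hθ1 : θ < 1 := by nlinarith
  have hθB : θ * B ≤ 1 := by nlinarith
  have hθE : lam * A * (2 * (θ * B)) ≤ δ := by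
    have h1 : θ * (lam * A * (2 * B) / δ) ≤ 1 := by nlinarith
    have h2 := mul_le_mul_of_nonneg_right h1 hδ.le
    have h3 : θ * (lam * A * (2 * B) / δ) * δ = lam * A * (2 * (θ * B)) := by field_simp
    linarith
  have hed (x) : HasDerivAt (fun x => exp (θ * w x)) (exp (θ * w x) * (θ * ρ x)) x :=
    ((hwd x).const_mul θ).exp
  refine ⟨θ⁻¹ - 1, fun x => exp (θ * w x) / (θ * lam), fun x => ρ x * exp (θ * w x) / lam,
    fun x => (ρ' x + θ * ρ x ^ 2) * exp (θ * w x) / lam, sub_pos.2 ((one_lt_inv₀ hθ).2 hθ1),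
    ⟨fun x _ => ?_, fun x _ => ?_, by fun_prop⟩, fun x _ => by positivity, ?_, ?_, fun x hx => ?_⟩
  · refine ((hed x).div_const (θ * lam)).hasDerivWithinAt.congr_deriv ?_
    field_simp
  · refine (((hρd x).mul (hed x)).div_const lam).hasDerivWithinAt.congr_deriv ?_
    ring
  · positivity
  · exact div_nonpos_of_nonpos_of_nonneg
      (mul_nonpos_of_nonpos_of_nonneg hρL (exp_pos _).le) hlam.le
  · have hθw : |-(θ * w x)| ≤ θ * B := by
      rw [abs_neg, abs_mul, abs_of_pos hθ]
      exact mul_le_mul_of_nonneg_left (hB x hx) hθ.le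
    have h1 : |a x * (exp (-(θ * w x)) - 1)| ≤ A * (2 * (θ * B)) := by
      rw [abs_mul]
      have h2 := abs_exp_sub_one_le (hθw.trans hθB)
      exact mul_le_mul (hA x hx) (h2.trans (by linarith)) (abs_nonneg _) hA0
    have h3 := mul_le_mul_of_nonneg_left (neg_le_of_abs_le h1) hlam.le
    have h4 : 0 ≤ ρ' x + ρ x ^ 2 + lam * (a x * exp (-(θ * w x))) := by
      have := hric x hx
      linarith
    have hE := exp_pos (θ * w x)
    rw [exp_neg] at h4
    have h5 := mul_nonneg h4 (div_pos hE hlam).le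
    have e1 : (ρ' x + ρ x ^ 2 + lam * (a x * (exp (θ * w x))⁻¹)) * (exp (θ * w x) / lam) =
        (ρ' x + ρ x ^ 2) * exp (θ * w x) / lam + a x := by field_simp
    have e2 : (θ⁻¹ - 1) * ((ρ x * exp (θ * w x) / lam) ^ 2 / (exp (θ * w x) / (θ * lam))) =
        (1 - θ) * ρ x ^ 2 * exp (θ * w x) / lam := by field_simp
    rw [e1] at h5
    rw [e2]
    have e3 : (1 - θ) * ρ x ^ 2 * exp (θ * w x) / lam + (ρ' x + θ * ρ x ^ 2) * exp (θ * w x) / lam =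
      (ρ' x + ρ x ^ 2) * exp (θ * w x) / lam := by ring
    linarith

/-- One-dimensional characterization of the Neumann existence set `I_N = (q̂_N, 1)`:
for a sign-changing continuous weight with `∫₀^L a < 0`, there exists `q̂_N ∈ [0, 1)`
such that, for `q ∈ (0, 1)`, the Neumann problem has a strongly positive solution iff
`q̂_N < q`. -/
theorem stmt_18 (L : ℝ) (hL : 0 < L)
    (a : ℝ → ℝ) (ha : ContinuousOn a (Set.Icc 0 L)) (hsign : ChangesSign L a)
    (hA0 : (∫ x in (0 : ℝ)..L, a x) < 0) :
    ∃ qhatN : ℝ, 0 ≤ qhatN ∧ qhatN < 1 ∧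
      ∀ q : ℝ, 0 < q → q < 1 →
        ((∃ u u' u'' : ℝ → ℝ, NeumannSolution L q a u u' u'' ∧
            ∀ x ∈ Set.Icc (0 : ℝ) L, 0 < u x) ↔ qhatN < q) := by
  set S : Set ℝ := {γ | 0 < γ ∧ ∃ v v' v'', IsSub L γ a v v' v''} with hS
  have hne : S.Nonempty := by
    obtain ⟨γ, v, v', v'', hγ, h⟩ := exists_isSub hL ha hsign.1
    exact ⟨γ, hγ, v, v', v'', h⟩
  have hbdd : BddBelow S := ⟨0, fun γ hγ => hγ.1.le⟩
  have hg : 0 ≤ sInf S := le_csInf hne fun γ hγ => hγ.1.le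
  refine ⟨sInf S / (1 + sInf S), by positivity, (div_lt_one (by positivity)).2 (by linarith),
    fun q hq0 hq1 => ?_⟩
  have hq : 0 < 1 - q := by linarith
  have hiff : sInf S / (1 + sInf S) < q ↔ sInf S < q / (1 - q) := by
    rw [div_lt_iff₀ (by positivity), lt_div_iff₀ hq]
    constructor <;> intro h <;> linarith
  rw [hiff]
  constructor
  · rintro ⟨u, u', u'', hu, hupos⟩
    obtain ⟨v, v', v'', hv, hvpos, h0, h1, heq⟩ := hu.isC2_rpow hq1 hupos
    obtain ⟨δ, w, w', w'', hδ, hδq, hw⟩ :=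
      exists_isSub_lt hL (div_pos hq0 hq) hA0 hv hvpos h0 h1 heq
    exact (csInf_le hbdd ⟨hδ, w, w', w'', hw⟩).trans_lt hδq
  · intro h
    obtain ⟨γ, ⟨-, v, v', v'', hv⟩, hγ⟩ := exists_lt_of_csInf_lt hne h
    exact (hv.mono hγ.le).exists_neumannSolution hL ha hA0 hq0.le hq1
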